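/- Let R be a commutative valuation ring with maximal ideal M, and let Z be its set of zero divisors. If Z ≠ 0 and Z ≠ M, then every finitely 2-presented R-module is finitely ∞-presented (so R is strong 2-coherent), and moreover there exists a finitely presented R-module that is not finitely 2-presented (so the inclusion FP_∞(R) = FP_2(R) ⊊ FP_1(R) is strict and R is not coherent). -/

import Mathlib

/-- An `R`-module `M` is finitely `n`-presented if there is an exact sequence
`F_n → F_{n-1} → ⋯ → F_0 → M → 0` of `R`-modules in which every `F_i` is finitely
generated free. (Encoded by an infinite chain of finitely generated free modules which is
required to be exact only at `F_0, …, F_{n-1}` and at `M`.) For `n = 0` this says that `M`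
is finitely generated, for `n = 1` that `M` is finitely presented. -/
def IsFinNPresented (R : Type) [Ring R] (n : ℕ) (M : Type) [AddCommGroup M] [Module R M] :
    Prop :=
  ∃ (k : ℕ → ℕ) (f : ∀ i : ℕ, (Fin (k (i + 1)) → R) →ₗ[R] (Fin (k i) → R))
    (g : (Fin (k 0) → R) →ₗ[R] M),
    Function.Surjective g ∧
    (0 < n → LinearMap.ker g = LinearMap.range (f 0)) ∧
    ∀ i : ℕ, i + 1 < n → LinearMap.ker (f i) = LinearMap.range (f (i + 1))


/-- An `R`-module `M` is finitely `∞`-presented if it admits a resolution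
`⋯ → F_1 → F_0 → M → 0` by finitely generated free `R`-modules. -/
def IsFinInfPresented (R : Type) [Ring R] (M : Type) [AddCommGroup M] [Module R M] : Prop :=
  ∃ (k : ℕ → ℕ) (f : ∀ i : ℕ, (Fin (k (i + 1)) → R) →ₗ[R] (Fin (k i) → R))
    (g : (Fin (k 0) → R) →ₗ[R] M),
    Function.Surjective g ∧
    LinearMap.ker g = LinearMap.range (f 0) ∧
    ∀ i : ℕ, LinearMap.ker (f i) = LinearMap.range (f (i + 1))


lemma aux_min {R : Type} [CommRing R] (hd : ∀ a b : R, a ∣ b ∨ b ∣ a) {ι : Type} (x : ι → R)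
    (t : Finset ι) (ht : t.Nonempty) : ∃ i ∈ t, ∀ j ∈ t, x i ∣ x j := by
  classical
  induction ht using Finset.Nonempty.cons_induction with
  | singleton a => exact ⟨a, by simp, by simp⟩
  | cons a t ha hne ih =>
    obtain ⟨i, hi, h⟩ := ih
    rcases hd (x a) (x i) with h1 | h1
    · refine ⟨a, by simp, fun j hj => ?_⟩
      rcases Finset.mem_cons.1 hj with rfl | hj
      · exact dvd_rfl
      · exact h1.trans (h j hj)
    · refine ⟨i, by simp [hi], fun j hj => ?_⟩
      rcases Finset.mem_cons.1 hj with rfl | hj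
      · exact h1
      · exact h j hj

lemma aux_free {R : Type} [CommRing R] [IsLocalRing R] (hd : ∀ a b : R, a ∣ b ∨ b ∣ a)
    (s : R) (hs : ∀ c, s * c = 0 → c = 0) (hsu : ¬ IsUnit s)
    (P : Type) [AddCommGroup P] [Module R P] [Module.FinitePresentation R P]
    (htf : ∀ r : R, (∀ c, r * c = 0 → c = 0) → ∀ p : P, r • p = 0 → p = 0) :
    ∃ c : ℕ, Nonempty ((Fin c → R) ≃ₗ[R] P) := by
  classical
  have hex : ∃ k : ℕ, ∃ g : (Fin k → R) →ₗ[R] P, Function.Surjective g :=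
    Module.Finite.exists_fin' R P
  let k := Nat.find hex
  obtain ⟨g, hg⟩ : ∃ g : (Fin k → R) →ₗ[R] P, Function.Surjective g := Nat.find_spec hex
  have hmin : ∀ k' < k, ¬ ∃ g : (Fin k' → R) →ₗ[R] P, Function.Surjective g :=
    fun k' h => Nat.find_min hex h
  have hone : ∀ y : Fin k → R, g y = 0 → ∀ i, y i ≠ 1 := by
    generalize k = k at *
    intro y hy i hi
    obtain _ | k := k
    · exact i.elim0
    refine hmin k (by omega) ⟨g ∘ₗ LinearMap.pi
      (fun j => Fin.insertNth (α := fun _ => (Fin k → R) →ₗ[R] R) i 0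
        (fun l => LinearMap.proj l) j), fun p => ?_⟩
    obtain ⟨x, rfl⟩ := hg p
    refine ⟨fun l => (x - x i • y) (i.succAbove l), ?_⟩
    have : x - x i • y = LinearMap.pi
      (fun j => Fin.insertNth (α := fun _ => (Fin k → R) →ₗ[R] R) i 0
        (fun l => LinearMap.proj l) j) (fun l => (x - x i • y) (i.succAbove l)) := by
      ext j
      rcases Fin.eq_self_or_eq_succAbove i j with rfl | ⟨l, rfl⟩
      · simp [hi]
      · simp
    rw [LinearMap.comp_apply, ← this]
    simp [hy]
  have hfg : (LinearMap.ker g).FG := Module.FinitePresentation.fg_ker g hg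
  have hker : LinearMap.ker g = ⊥ := by
    refine Submodule.eq_bot_of_le_smul_of_le_jacobson_bot (Ideal.span {s}) _ hfg ?_ ?_
    · intro x hx
      have hx' : g x = 0 := hx
      by_cases hall : ∀ i, s ∣ x i
      · choose y hy using hall
        have hxy : x = s • y := by ext i; simp [hy i]
        have hgy : g y = 0 := htf s hs _ (by rw [← map_smul, ← hxy, hx'])
        rw [hxy]
        exact Submodule.smul_mem_smul (Ideal.mem_span_singleton_self s) hgy
      · exfalso
        push Not at hall
        obtain ⟨j, hj⟩ := hall
        obtain ⟨i, -, hi⟩ := aux_min hd x Finset.univ ⟨j, Finset.mem_univ _⟩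
        have hxs : x i ∣ s := (hi j (Finset.mem_univ _)).trans ((hd s (x j)).resolve_left hj)
        have hreg : ∀ c, x i * c = 0 → c = 0 := by
          intro c hc
          obtain ⟨d, hd'⟩ := hxs
          apply hs
          rw [hd', mul_right_comm, hc, zero_mul]
        choose y hy using fun j => hi j (Finset.mem_univ j)
        have hxy : x = x i • y := by ext l; simpa using hy l
        have hgy : g y = 0 := htf _ hreg _ (by rw [← map_smul, ← hxy, hx'])
        refine hone y hgy i ?_
        have : x i * (y i - 1) = 0 := by rw [mul_sub, ← hy i]; ring
        exact sub_eq_zero.1 (hreg _ this)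
    · rw [IsLocalRing.jacobson_eq_maximalIdeal ⊥ bot_ne_top, Ideal.span_singleton_le_iff_mem]
      exact hsu
  exact ⟨k, ⟨LinearEquiv.ofBijective g ⟨LinearMap.ker_eq_bot.1 hker, hg⟩⟩⟩

lemma aux_schanuel {R F G N : Type} [CommRing R] [AddCommGroup F] [Module R F]
    [AddCommGroup G] [Module R G] [AddCommGroup N] [Module R N]
    [Module.Projective R F] [Module.FinitePresentation R G]
    (g : F →ₗ[R] N) (h : G →ₗ[R] N) (hg : Function.Surjective g) (hh : Function.Surjective h)
    [Module.FinitePresentation R (LinearMap.ker g)] :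
    Module.FinitePresentation R (LinearMap.ker h) := by
  let X : Submodule R (F × G) := LinearMap.ker (g ∘ₗ LinearMap.fst R F G - h ∘ₗ LinearMap.snd R F G)
  have hX : ∀ p : F × G, p ∈ X ↔ g p.1 = h p.2 := fun p => by
    simp [X, sub_eq_zero]
  let q : X →ₗ[R] G := LinearMap.snd R F G ∘ₗ X.subtype
  let p : X →ₗ[R] F := LinearMap.fst R F G ∘ₗ X.subtype
  have hq : Function.Surjective q := fun y => by
    obtain ⟨x, hx⟩ := hg (h y)
    exact ⟨⟨(x, y), (hX _).2 hx⟩, rfl⟩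
  have hp : Function.Surjective p := fun x => by
    obtain ⟨y, hy⟩ := hh (g x)
    exact ⟨⟨(x, y), (hX _).2 hy.symm⟩, rfl⟩
  let e : LinearMap.ker g →ₗ[R] LinearMap.ker q :=
    LinearMap.codRestrict _ (LinearMap.codRestrict X
      (LinearMap.inl R F G ∘ₗ (LinearMap.ker g).subtype) (fun c => (hX _).2 (by simp)))
      (fun c => by
        rw [LinearMap.mem_ker]; rfl)
  have he : Function.Bijective e := by
    constructor
    · intro a b hab
      have : (e a).1.1.1 = (e b).1.1.1 := by rw [hab]
      exact Subtype.ext this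
    · rintro ⟨⟨⟨a, b⟩, hab⟩, hb⟩
      have hb' : b = 0 := hb
      subst hb'
      refine ⟨⟨a, ?_⟩, rfl⟩
      have := (hX _).1 hab
      simpa using this
  have : Module.FinitePresentation R (LinearMap.ker q) := by
    have E := LinearEquiv.ofBijective e he
    exact (LinearEquiv.finitePresentation_iff (R := R) (M := LinearMap.ker g)
      (N := LinearMap.ker q) E).1 inferInstance
  have : Module.FinitePresentation R X := Module.finitePresentation_of_ker q hq
  let j : LinearMap.ker h →ₗ[R] X := LinearMap.codRestrict X
      (LinearMap.inr R F G ∘ₗ (LinearMap.ker h).subtype) (fun c => (hX _).2 (by simp))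
  refine Module.finitePresentation_of_projective_of_exact j p ?_ hp ?_
  · intro a b hab
    have : (j a).1.2 = (j b).1.2 := by rw [hab]
    exact Subtype.ext this
  · rintro ⟨⟨a, b⟩, hab⟩
    constructor
    · intro (ha : a = 0)
      subst ha
      have := (hX _).1 hab
      exact ⟨⟨b, by simpa using this.symm⟩, rfl⟩
    · rintro ⟨c, hc⟩
      rw [← hc]; rfl

lemma aux_fp {R : Type} [CommRing R] {a b : ℕ} (f : (Fin a → R) →ₗ[R] (Fin b → R))
    (h : (LinearMap.ker f).FG) : Module.FinitePresentation R (LinearMap.range f) := by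
  refine Module.finitePresentation_of_surjective f.rangeRestrict f.surjective_rangeRestrict ?_
  rwa [LinearMap.ker_rangeRestrict]

lemma aux_tf {R : Type} [CommRing R] {b : ℕ} (P : Submodule R (Fin b → R)) :
    ∀ r : R, (∀ c, r * c = 0 → c = 0) → ∀ p : P, r • p = 0 → p = 0 := by
  intro r hr p hp
  ext i
  apply hr
  have := congrArg (fun q : P => q.1 i) hp
  simpa using this

def auxK (a c : ℕ) : ℕ → ℕ
  | 0 => a
  | 1 => c
  | _ => 0

def auxF {R : Type} [CommRing R] (a c : ℕ) (e : (Fin c → R) →ₗ[R] (Fin a → R)) :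
    ∀ i : ℕ, (Fin (auxK a c (i + 1)) → R) →ₗ[R] (Fin (auxK a c i) → R)
  | 0 => e
  | _ + 1 => 0

/-- Let `R` be a commutative valuation ring (ideals totally ordered by
inclusion) with maximal ideal `M`, and let `Z` be its set of zero divisors. If `Z ≠ 0`
and `Z ≠ M`, then every finitely `2`-presented `R`-module is finitely `∞`-presented
(so `FP_∞(R) = FP_2(R)` and in particular `R` is strong `2`-coherent), and there is a
finitely presented `R`-module (a quotient of a finitely generated free module) which is
not finitely `2`-presented (so `FP_2(R) ⊊ FP_1(R)`). -/
theorem valuation_ring_zero_divisors_ne_maximal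
    (R : Type) [CommRing R]
    (hval : ∀ I J : Ideal R, I ≤ J ∨ J ≤ I)
    (M : Ideal R) (hM : M.IsMaximal)
    (Z : Set R) (hZ : Z = {r : R | ∃ s : R, s ≠ 0 ∧ r * s = 0})
    (hZ0 : Z ≠ {0}) (hZM : Z ≠ (M : Set R)) :
    (∀ (N : Type) [AddCommGroup N] [Module R N],
        IsFinNPresented R 2 N → IsFinInfPresented R N) ∧
    (∃ (m : ℕ) (K : Submodule R (Fin m → R)),
        IsFinNPresented R 1 ((Fin m → R) ⧸ K) ∧
        ¬ IsFinNPresented R 2 ((Fin m → R) ⧸ K)) := by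
  have hdv : ∀ a b : R, a ∣ b ∨ b ∣ a := by
    intro a b
    have := hval (Ideal.span {a}) (Ideal.span {b})
    simp only [Ideal.span_singleton_le_span_singleton] at this
    exact this.symm
  have : Nontrivial R := nontrivial_of_ne _ _ (fun h => hM.ne_top ((Ideal.eq_top_iff_one M).2 (h ▸ M.zero_mem) : M = ⊤) : (0 : R) ≠ 1)
  have : PreValuationRing R := PreValuationRing.iff_dvd_total.2 ⟨hdv⟩
  have hMm : M = IsLocalRing.maximalIdeal R := IsLocalRing.eq_maximalIdeal hM
  obtain ⟨s, hs, hsu⟩ : ∃ s : R, (∀ c, s * c = 0 → c = 0) ∧ ¬ IsUnit s := by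
    by_contra hcon
    push Not at hcon
    apply hZM
    ext r
    rw [hZ, hMm, SetLike.mem_coe, IsLocalRing.mem_maximalIdeal]
    constructor
    · rintro ⟨t, ht, hrt⟩ hu
      exact ht ((hu.mul_right_eq_zero).1 hrt)
    · intro hr
      by_contra hn
      apply hr
      apply hcon
      intro c hc
      by_contra hc0
      exact hn ⟨c, hc0, hc⟩
  constructor
  · rintro N _ _ ⟨k, f, g, hg, h0, h1⟩
    have h0 := h0 (by norm_num)
    have h1 := h1 0 (by norm_num)
    have := aux_fp (f 0) (by rw [h1]; exact Submodule.FG.of_finite)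
    obtain ⟨c, ⟨e⟩⟩ := aux_free hdv s hs hsu (LinearMap.range (f 0)) (aux_tf _)
    let e' : (Fin c → R) →ₗ[R] (Fin (k 0) → R) := (LinearMap.range (f 0)).subtype ∘ₗ e.toLinearMap
    have hr : LinearMap.range e' = LinearMap.range (f 0) := by
      rw [LinearMap.range_comp, LinearEquiv.range, Submodule.map_top, Submodule.range_subtype]
    have hi : Function.Injective e' := Subtype.val_injective.comp e.injective
    refine ⟨auxK (k 0) c, auxF (k 0) c e', g, hg, ?_, ?_⟩
    · exact h0.trans hr.symm
    · rintro (_ | i)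
      · show LinearMap.ker e' = LinearMap.range 0
        rw [LinearMap.ker_eq_bot.2 hi, LinearMap.range_zero]
      · have : Subsingleton (Fin (auxK (k 0) c (i + 1 + 1)) → R) :=
          inferInstanceAs (Subsingleton (Fin 0 → R))
        have : Subsingleton (Submodule R (Fin (auxK (k 0) c (i + 1 + 1)) → R)) := inferInstance
        rcases i with _ | i
        all_goals
          ext x
          rw [Subsingleton.elim x 0]
          exact ⟨fun _ => Submodule.zero_mem _, fun _ => Submodule.zero_mem _⟩
  · obtain ⟨a, haZ, ha0⟩ : ∃ a ∈ Z, a ≠ 0 := by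
      by_contra hcon
      push Not at hcon
      apply hZ0
      ext r
      refine ⟨fun h => hcon r h, ?_⟩
      rintro rfl
      rw [hZ]
      exact ⟨1, one_ne_zero, by simp⟩
    rw [hZ] at haZ
    obtain ⟨t, ht0, hat⟩ := haZ
    let m : (Fin 1 → R) →ₗ[R] (Fin 1 → R) := a • LinearMap.id
    refine ⟨1, LinearMap.range m, ?_, ?_⟩
    · refine ⟨fun _ => 1, fun _ => m, (LinearMap.range m).mkQ, Submodule.mkQ_surjective _,
        fun _ => Submodule.ker_mkQ _, fun i hi => by omega⟩
    · rintro ⟨k, f, g, hg, h0, h1⟩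
      have h0 := h0 (by norm_num)
      have h1 := h1 0 (by norm_num)
      have := aux_fp (f 0) (by rw [h1]; exact Submodule.FG.of_finite)
      rw [← h0] at this
      have hK := aux_schanuel g (LinearMap.range m).mkQ hg (Submodule.mkQ_surjective _)
      rw [Submodule.ker_mkQ] at hK
      obtain ⟨c, ⟨e⟩⟩ := aux_free hdv s hs hsu (LinearMap.range m) (aux_tf _)
      have htz : ∀ p : LinearMap.range m, t • p = 0 := by
        rintro ⟨_, x, rfl⟩
        ext i
        simp only [m, Submodule.coe_smul, LinearMap.smul_apply, LinearMap.id_apply,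
          Pi.smul_apply, smul_eq_mul, Submodule.coe_zero, Pi.zero_apply]
        rw [← mul_assoc, mul_comm t a, hat, zero_mul]
      obtain _ | c := c
      · have h2 : (⟨m 1, 1, rfl⟩ : LinearMap.range m) = 0 := by
          rw [← e.apply_symm_apply ⟨m 1, 1, rfl⟩, Subsingleton.elim (e.symm _) 0, map_zero]
        have h3 := congrFun (congrArg Subtype.val h2) 0
        apply ha0
        simpa [m] using h3
      · have h2 : t • (1 : Fin (c + 1) → R) = 0 := by
          apply e.injective
          rw [map_smul, htz, map_zero]
        apply ht0
        simpa using congrFun h2 0
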